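/- arXiv:0910.3890 — 4 statements merged into one kernel-verified Lean document; each statement's English description precedes it below -/
import Mathlib

section
/- Let F : ℝ^n → ℝ^n be a smooth vector field, U ⊆ ℝ^n open, and Θ : U → ℝ a smooth function whose directional derivative along F is constant: Θ^(1)_y(F(y)) = ω for all y ∈ U. Let x : I → U be differentiable with x'(t) = F(x(t)) on an interval I. Then for every integer k ≥ 1 and all vectors v_1, …, v_k ∈ ℝ^n and all t ∈ I, (d/dt)[Θ^(k)_{x(t)}(v_1,…,v_k)] + k·(Θ^(k)_{x(t)} ⊙ F^(1)_{x(t)})(v_1,…,v_k) = − Σ_{l=1}^{k−1} binom(k, l+1)·(Θ^(k−l)_{x(t)} ⊙ F^(l+1)_{x(t)})(v_1,…,v_k), where for k = 1 the right-hand side is 0. -/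
open scoped BigOperators

/-- The symmetric composition `Q ⊙ H` of a symmetric `(s+1)`-multilinear scalar-valued
map `Q` and a `k`-multilinear vector-valued map `H`, as a `(k+s)`-multilinear map:
`(Q ⊙ H)(v₁,…,v_{k+s}) = (1/(k+s)!) ∑_{σ} Q(H(v_{σ(1)},…,v_{σ(k)}), v_{σ(k+1)},…,v_{σ(k+s)})`. -/
noncomputable def symComp {E : Type*} {s k : ℕ}
    (Q : (Fin (s + 1) → E) → ℝ) (H : (Fin k → E) → E) :
    (Fin (k + s) → E) → ℝ := fun v =>
  ((k + s).factorial : ℝ)⁻¹ *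
    ∑ σ : Equiv.Perm (Fin (k + s)),
      Q (Fin.cons (H fun i => v (σ (Fin.castAdd s i))) fun j => v (σ (Fin.natAdd k j)))

section SymmetricMultilinear

variable {E : Type*} [NormedAddCommGroup E] [NormedSpace ℝ E] {m : ℕ}

/-- A scalar function of `m` vectors which is a continuous symmetric multilinear map. -/
def IsSymmMultilinear (f : (Fin m → E) → ℝ) : Prop :=
  (∃ M : E [×m]→L[ℝ] ℝ, ∀ v, M v = f v) ∧
    ∀ (v : Fin m → E) (σ : Equiv.Perm (Fin m)), f (v ∘ σ) = f v

namespace IsSymmMultilinear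

variable {f g : (Fin m → E) → ℝ}

theorem add (hf : IsSymmMultilinear f) (hg : IsSymmMultilinear g) :
    IsSymmMultilinear fun v => f v + g v := by
  obtain ⟨⟨M, hM⟩, hf⟩ := hf
  obtain ⟨⟨N, hN⟩, hg⟩ := hg
  exact ⟨⟨M + N, fun v => by simp [hM, hN]⟩, fun v σ => by simp only [hf, hg]⟩

theorem const_mul (hf : IsSymmMultilinear f) (c : ℝ) : IsSymmMultilinear fun v => c * f v := by
  obtain ⟨⟨M, hM⟩, hf⟩ := hf
  exact ⟨⟨c • M, fun v => by simp [hM]⟩, fun v σ => by simp only [hf]⟩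

theorem sum {ι : Type*} (s : Finset ι) {f : ι → (Fin m → E) → ℝ}
    (hf : ∀ i ∈ s, IsSymmMultilinear (f i)) : IsSymmMultilinear fun v => ∑ i ∈ s, f i v := by
  induction s using Finset.cons_induction with
  | empty => exact ⟨⟨0, fun v => by simp⟩, fun v σ => by simp⟩
  | cons a s ha ih =>
    simp only [Finset.sum_cons]
    exact (hf a (by simp)).add (ih fun i hi => hf i (by simp [hi]))

theorem cast {m' : ℕ} (h : m = m') (hf : IsSymmMultilinear f) :
    IsSymmMultilinear fun v : Fin m' → E => f fun i => v (Fin.cast h i) := by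
  subst h
  exact hf

/-- A symmetric multilinear map is determined by its values on the diagonal. -/
theorem eq_zero_of_diag (hf : IsSymmMultilinear f) (h : ∀ w, f (fun _ => w) = 0)
    (v : Fin m → E) : f v = 0 := by
  obtain ⟨⟨M, hM⟩, hf⟩ := hf
  have key := M.iteratedFDeriv_comp_diagonal 0 v
  have h0 : (fun x : E => M fun _ => x) = fun _ => 0 := by
    funext w
    rw [hM, h]
  have hσ (σ : Equiv.Perm (Fin m)) : M (fun i => v (σ i)) = f v := by
    rw [hM]
    exact hf v σ
  have hz : iteratedFDeriv ℝ m (fun _ : E => (0 : ℝ)) = 0 := iteratedFDeriv_fun_zero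
  rw [h0, hz] at key
  simp only [hσ, Finset.sum_const, Finset.card_univ, Fintype.card_perm, Fintype.card_fin,
    nsmul_eq_mul, Pi.zero_apply, zero_apply] at key
  exact (mul_eq_zero.mp key.symm).resolve_left (by positivity)

theorem symComp {s k : ℕ} (Q : E [×(s + 1)]→L[ℝ] ℝ) (H : E [×k]→L[ℝ] E) :
    IsSymmMultilinear (symComp (s := s) (fun w => Q w) (fun w => H w)) := by
  let L : MultilinearMap ℝ (fun _ : Fin s ⊕ Fin k => E) ℝ :=
    (TensorProduct.lift (ContinuousLinearMap.coeLM ℝ)).compMultilinearMap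
      (MultilinearMap.domCoprod Q.curryLeft.flipMultilinear.toMultilinearMap H.toMultilinearMap)
  have hL (u) : L u = Q (Fin.cons (H fun i => u (Sum.inr i)) fun j => u (Sum.inl j)) := rfl
  let M : E [×(k + s)]→L[ℝ] ℝ :=
    { toMultilinearMap := L.domDomCongr ((Equiv.sumComm _ _).trans finSumFinEquiv)
      cont := by
        change Continuous fun v : Fin (k + s) → E =>
          Q (Fin.cons (H fun i => v (Fin.castAdd s i)) fun j => v (Fin.natAdd k j))
        refine Q.cont.comp (continuous_pi fun i => ?_)
        refine Fin.cases ?_ (fun j => ?_) i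
        · exact H.cont.comp (by fun_prop)
        · simp only [Fin.cons_succ]
          fun_prop }
  refine ⟨⟨((k + s).factorial : ℝ)⁻¹ • ∑ σ : Equiv.Perm (Fin (k + s)), M.domDomCongr σ,
    fun v => ?_⟩, fun v τ => ?_⟩
  · simp only [smul_apply, sum_apply,
      smul_eq_mul]
    rfl
  · simp only [_root_.symComp]
    congr 1
    exact Equiv.sum_comp (Equiv.mulLeft τ) fun σ : Equiv.Perm (Fin (k + s)) =>
      Q (Fin.cons (H fun i => v (σ (Fin.castAdd s i))) fun j => v (σ (Fin.natAdd k j)))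

end IsSymmMultilinear

theorem symComp_diag {E : Type*} {s k : ℕ} (Q : (Fin (s + 1) → E) → ℝ) (H : (Fin k → E) → E)
    (w : E) :
    symComp Q H (fun _ => w) = Q (Fin.cons (H fun _ => w) fun _ => w) := by
  have : ((k + s).factorial : ℝ) ≠ 0 := by positivity
  simp [symComp, Fintype.card_perm, this]

end SymmetricMultilinear

section Calculus

variable {E G H : Type*} [NormedAddCommGroup E] [NormedSpace ℝ E] [NormedAddCommGroup G]
  [NormedSpace ℝ G] [NormedAddCommGroup H] [NormedSpace ℝ H] {U : Set E}

theorem iteratedFDeriv_comp_swap {f : E → G} (hU : IsOpen U)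
    (hf : ContDiffOn ℝ (⊤ : ℕ∞) f U) {n : ℕ} (i : Fin n) {y : E} (hy : y ∈ U)
    (v : Fin (n + 1) → E) :
    iteratedFDeriv ℝ (n + 1) f y (v ∘ Equiv.swap i.castSucc i.succ) =
      iteratedFDeriv ℝ (n + 1) f y v := by
  have hd (j : ℕ) {z : E} (hz : z ∈ U) : ContDiffAt ℝ 2 (iteratedFDeriv ℝ j f) z :=
    (hf.contDiffAt (hU.mem_nhds hz)).iteratedFDeriv_right
      (WithTop.coe_le_coe.mpr le_top : ((2 + j : ℕ∞) : WithTop ℕ∞) ≤ (⊤ : ℕ∞))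
  induction n generalizing y with
  | zero => exact i.elim0
  | succ n ih =>
    refine Fin.cases ?_ (fun i => ?_) i
    · have hs := (hd n hy).isSymmSndFDerivAt (by simp)
      have h2 (u : Fin (n + 2) → E) : iteratedFDeriv ℝ (n + 2) f y u =
          fderiv ℝ (fderiv ℝ (iteratedFDeriv ℝ n f)) y (u 0) (u 1) (fun j => u j.succ.succ) := by
        rw [((hd (n + 1) hy).differentiableAt (by simp)).iteratedFDeriv_succ_apply_left']
        have hdd : DifferentiableAt ℝ (fderiv ℝ (iteratedFDeriv ℝ n f)) y :=
          ((hd n hy).fderiv_right (m := 1) (by norm_num)).differentiableAt (by simp)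
        have := ((hdd.hasFDerivAt.clm_apply (hasFDerivAt_const (u 1) y)).continuousMultilinear_apply_const
          (fun j => u j.succ.succ)).fderiv
        refine (congrArg (fun T => T (u 0)) this).trans ?_
        simp
      rw [h2, h2, hs.eq]
      congr 2
    · rw [((hd (n + 1) hy).differentiableAt (by simp)).iteratedFDeriv_succ_apply_left',
        ((hd (n + 1) hy).differentiableAt (by simp)).iteratedFDeriv_succ_apply_left']
      have h0 : (v ∘ Equiv.swap i.succ.castSucc i.succ.succ) 0 = v 0 := by
        simp only [Function.comp_apply]
        rw [Equiv.swap_apply_of_ne_of_ne] <;> simp [Fin.ext_iff]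
      have ht : Fin.tail (v ∘ Equiv.swap i.succ.castSucc i.succ.succ) =
          Fin.tail v ∘ Equiv.swap i.castSucc i.succ := by
        funext j
        simp only [Fin.tail, Function.comp_apply]
        congr 1
        simp only [Equiv.swap_apply_def, Fin.ext_iff]
        split_ifs <;> simp_all
      rw [h0, ht]
      refine congrArg (fun T : E →L[ℝ] G => T (v 0)) (Filter.EventuallyEq.fderiv_eq ?_)
      filter_upwards [hU.mem_nhds hy] with z hz
      exact ih i hz _

/-- Symmetry of the iterated derivatives of a smooth function on a real normed space. -/
theorem iteratedFDeriv_comp_perm_of_contDiffOn {f : E → G} (hU : IsOpen U)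
    (hf : ContDiffOn ℝ (⊤ : ℕ∞) f U) {n : ℕ} {y : E} (hy : y ∈ U) (v : Fin n → E)
    (σ : Equiv.Perm (Fin n)) :
    iteratedFDeriv ℝ n f y (v ∘ σ) = iteratedFDeriv ℝ n f y v := by
  cases n with
  | zero => congr 1; exact Subsingleton.elim _ _
  | succ n =>
    have hσ : σ ∈ Submonoid.closure
        (Set.range fun i : Fin n => Equiv.swap i.castSucc i.succ) := by
      rw [Equiv.Perm.mclosure_swap_castSucc_succ]
      trivial
    induction hσ using Submonoid.closure_induction generalizing v with
    | mem τ hτ =>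
      obtain ⟨i, rfl⟩ := hτ
      exact iteratedFDeriv_comp_swap hU hf i hy v
    | one => rfl
    | mul a b _ _ ha hb => exact (hb (v ∘ a)).trans (ha v)

theorem hasFDerivAt_iteratedFDeriv_diag {f : E → G} (hU : IsOpen U)
    (hf : ContDiffOn ℝ (⊤ : ℕ∞) f U) (k : ℕ) {y : E} (hy : y ∈ U) (w : E) :
    ∃ A : E →L[ℝ] G, HasFDerivAt (fun z => iteratedFDeriv ℝ k f z fun _ => w) A y ∧
      A w = iteratedFDeriv ℝ (k + 1) f y fun _ => w := by
  have hd : DifferentiableAt ℝ (iteratedFDeriv ℝ k f) y :=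
    (hf.contDiffAt (hU.mem_nhds hy)).differentiableAt_iteratedFDeriv
      (by exact_mod_cast WithTop.coe_lt_top k)
  exact ⟨_, hd.hasFDerivAt.continuousMultilinear_apply_const _, rfl⟩

/-- The Leibniz rule for iterated derivatives along a fixed direction. -/
theorem iteratedFDeriv_clm_apply_diag {f : E → G →L[ℝ] H} {g : E → G} (hU : IsOpen U)
    (hf : ContDiffOn ℝ (⊤ : ℕ∞) f U) (hg : ContDiffOn ℝ (⊤ : ℕ∞) g U) (k : ℕ) {y : E}
    (hy : y ∈ U) (w : E) :
    iteratedFDeriv ℝ k (fun z => f z (g z)) y (fun _ => w) =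
      ∑ ij ∈ Finset.HasAntidiagonal.antidiagonal k, k.choose ij.1 •
        (iteratedFDeriv ℝ ij.1 f y fun _ => w) (iteratedFDeriv ℝ ij.2 g y fun _ => w) := by
  induction k generalizing y with
  | zero => simp
  | succ k ih =>
    rw [Finset.sum_antidiagonal_choose_succ_nsmul (fun i j =>
      (iteratedFDeriv ℝ i f y fun _ => w) (iteratedFDeriv ℝ j g y fun _ => w))]
    obtain ⟨A, hA, hAw⟩ := hasFDerivAt_iteratedFDeriv_diag hU (hf.clm_apply hg) k hy w
    choose B hB hBw using fun i => hasFDerivAt_iteratedFDeriv_diag hU hf i hy w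
    choose C hC hCw using fun j => hasFDerivAt_iteratedFDeriv_diag hU hg j hy w
    have hsum := HasFDerivAt.fun_sum fun (ij : ℕ × ℕ) (_ : ij ∈ Finset.HasAntidiagonal.antidiagonal k) =>
      ((hB ij.1).clm_apply (hC ij.2)).const_smul (k.choose ij.1)
    have hev := Filter.eventually_of_mem (hU.mem_nhds hy) fun z hz => ih hz
    rw [← hAw, hA.unique (hsum.congr_of_eventuallyEq hev)]
    simp only [sum_apply, smul_apply, add_apply, ContinuousLinearMap.comp_apply,
      ContinuousLinearMap.flip_apply, hBw, hCw, smul_add, Finset.sum_add_distrib]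
    congr 1
    refine Finset.sum_congr rfl fun ij hij => ?_
    rw [Nat.choose_symm_of_eq_add (Finset.HasAntidiagonal.mem_antidiagonal.mp hij).symm]

theorem iteratedFDeriv_cons_const {Θ : E → ℝ} (hU : IsOpen U)
    (hΘ : ContDiffOn ℝ (⊤ : ℕ∞) Θ U) {y : E} (hy : y ∈ U) {m s : ℕ} (h : m = s + 1) (a w : E) :
    iteratedFDeriv ℝ m Θ y
        (fun i => (Fin.cons a fun _ => w : Fin (s + 1) → E) (Fin.cast h i)) =
      (iteratedFDeriv ℝ s (fderiv ℝ Θ) y fun _ => w) a := by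
  subst h
  have hsnoc : (Fin.cons a fun _ => w : Fin (s + 1) → E) ∘ finRotate (s + 1) =
      Fin.snoc (fun _ => w) a := by
    funext i
    refine Fin.lastCases ?_ (fun j => ?_) i <;> simp
  change iteratedFDeriv ℝ (s + 1) Θ y (Fin.cons a fun _ => w) = _
  rw [← iteratedFDeriv_comp_perm_of_contDiffOn hU hΘ hy _ (finRotate (s + 1)), hsnoc,
    iteratedFDeriv_succ_apply_right]
  simp

/-- The diagonal form of the identity obtained by differentiating `Θ'(F) = ω` repeatedly. -/
theorem sum_choose_iteratedFDeriv_eq_zero {Θ : E → ℝ} {F : E → E} (hU : IsOpen U)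
    (hΘ : ContDiffOn ℝ (⊤ : ℕ∞) Θ U) (hF : ContDiffOn ℝ (⊤ : ℕ∞) F U) {ω : ℝ}
    (hω : ∀ y ∈ U, fderiv ℝ Θ y (F y) = ω) (K : ℕ) {y : E} (hy : y ∈ U) (w : E) :
    ∑ j ∈ Finset.range (K + 2), ((K + 1).choose j : ℝ) *
      (iteratedFDeriv ℝ (K + 1 - j) (fderiv ℝ Θ) y fun _ => w)
        (iteratedFDeriv ℝ j F y fun _ => w) = 0 := by
  have hev : (fun z => fderiv ℝ Θ z (F z)) =ᶠ[nhds y] fun _ => ω :=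
    Filter.eventually_of_mem (hU.mem_nhds hy) hω
  have key := iteratedFDeriv_clm_apply_diag hU
    (hΘ.fderiv_of_isOpen hU (m := (⊤ : ℕ∞)) (by simp)) hF (K + 1) hy w
  rw [(hev.iteratedFDeriv ℝ (K + 1)).eq_of_nhds,
    iteratedFDeriv_const_of_ne (Nat.succ_ne_zero K), ← Finset.Nat.sum_antidiagonal_swap,
    Finset.Nat.sum_antidiagonal_eq_sum_range_succ_mk] at key
  refine Eq.trans (Finset.sum_congr rfl fun j hj => ?_) key.symm
  have hj' : j ≤ K + 1 := Nat.lt_succ_iff.mp (Finset.mem_range.mp hj)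
  simp [Nat.choose_symm hj']

end Calculus

/-- Part 1 of the main theorem: the differential equation satisfied by the `k`-th
derivative of the phase function along a trajectory (here the paper's `k ≥ 1` is `K + 1`). -/
theorem stmt_0 {n : ℕ}
    (F : EuclideanSpace ℝ (Fin n) → EuclideanSpace ℝ (Fin n)) (hF : ContDiff ℝ (⊤ : ℕ∞) F)
    (U : Set (EuclideanSpace ℝ (Fin n))) (hU : IsOpen U)
    (Θ : EuclideanSpace ℝ (Fin n) → ℝ) (hΘ : ContDiffOn ℝ (⊤ : ℕ∞) Θ U)
    (ω : ℝ) (hω : ∀ y ∈ U, fderiv ℝ Θ y (F y) = ω)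
    (I : Set ℝ) (hIopen : IsOpen I) (hIconn : I.OrdConnected)
    (x : ℝ → EuclideanSpace ℝ (Fin n)) (hxU : ∀ t ∈ I, x t ∈ U)
    (hxode : ∀ t ∈ I, HasDerivAt x (F (x t)) t)
    (K : ℕ) (v : Fin (K + 1) → EuclideanSpace ℝ (Fin n)) (t : ℝ) (ht : t ∈ I) :
    deriv (fun s => iteratedFDeriv ℝ (K + 1) Θ (x s) v) t
      + (K + 1 : ℝ) *
        symComp (s := K) (fun w => iteratedFDeriv ℝ (K + 1) Θ (x t) w)
          (fun w : Fin 1 → EuclideanSpace ℝ (Fin n) => fderiv ℝ F (x t) (w 0))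
          (fun i => v (Fin.cast (by omega) i))
    = - ∑ l : Fin K, ((K + 1).choose ((l : ℕ) + 2) : ℝ) *
        symComp (s := K - (l : ℕ) - 1)
          (fun w => iteratedFDeriv ℝ (K - (l : ℕ)) Θ (x t)
            (fun i => w (Fin.cast (by have := l.isLt; omega) i)))
          (fun w => iteratedFDeriv ℝ ((l : ℕ) + 2) F (x t) w)
          (fun i => v (Fin.cast (by have := l.isLt; omega) i)) := by
  have hderiv (v : Fin (K + 1) → EuclideanSpace ℝ (Fin n)) :
      deriv (fun s => iteratedFDeriv ℝ (K + 1) Θ (x s) v) t =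
        iteratedFDeriv ℝ (K + 2) Θ (x t) (Fin.cons (F (x t)) v) := by
    have hd : DifferentiableAt ℝ (iteratedFDeriv ℝ (K + 1) Θ) (x t) :=
      (hΘ.contDiffAt (hU.mem_nhds (hxU t ht))).differentiableAt_iteratedFDeriv
        (by exact_mod_cast WithTop.coe_lt_top (K + 1))
    exact ((hd.hasFDerivAt.continuousMultilinear_apply_const v).comp_hasDerivAt t
      (hxode t ht)).deriv
  have hsub (l : Fin K) : K - (l : ℕ) = K - (l : ℕ) - 1 + 1 := by omega
  have hsymm : IsSymmMultilinear fun v : Fin (K + 1) → EuclideanSpace ℝ (Fin n) =>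
      iteratedFDeriv ℝ (K + 2) Θ (x t) (Fin.cons (F (x t)) v) := by
    refine ⟨⟨(iteratedFDeriv ℝ (K + 2) Θ (x t)).curryLeft (F (x t)), fun v => rfl⟩,
      fun v σ => ?_⟩
    beta_reduce
    rw [← iteratedFDeriv_comp_perm_of_contDiffOn hU hΘ (hxU t ht) (Fin.cons (F (x t)) v)
      (Equiv.Perm.decomposeFin.symm (0, σ))]
    congr 1
    funext i
    refine Fin.cases ?_ (fun j => ?_) i <;> simp
  simp_rw [← iteratedFDeriv_one_apply]
  rw [hderiv, ← add_eq_zero_iff_eq_neg]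
  refine IsSymmMultilinear.eq_zero_of_diag ((hsymm.add
    (((IsSymmMultilinear.symComp (iteratedFDeriv ℝ (K + 1) Θ (x t))
      (iteratedFDeriv ℝ 1 F (x t))).cast (by omega)).const_mul (K + 1 : ℝ))).add
    (IsSymmMultilinear.sum (Finset.univ : Finset (Fin K)) fun l _ => ((IsSymmMultilinear.symComp
      ((iteratedFDeriv ℝ (K - (l : ℕ)) Θ (x t)).domDomCongr (finCongr (hsub l)))
      (iteratedFDeriv ℝ ((l : ℕ) + 2) F (x t))).cast
        (m' := K + 1) (by have := l.isLt; omega)).const_mul ((K + 1).choose ((l : ℕ) + 2) : ℝ))) (fun w => ?_) v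
  have key := sum_choose_iteratedFDeriv_eq_zero hU hΘ hF.contDiffOn hω K (hxU t ht) w
  rw [Finset.sum_range_succ', Finset.sum_range_succ', Finset.sum_range] at key
  have hcons (s : ℕ) (a) : iteratedFDeriv ℝ (s + 1) Θ (x t) (Fin.cons a fun _ => w) =
      (iteratedFDeriv ℝ s (fderiv ℝ Θ) (x t) fun _ => w) a :=
    iteratedFDeriv_cons_const hU hΘ (hxU t ht) rfl a w
  have hterm (l : Fin K) (a) := iteratedFDeriv_cons_const hU hΘ (hxU t ht) (hsub l) a w
  have hexp (l : Fin K) : K + 1 - ((l : ℕ) + 1 + 1) = K - (l : ℕ) - 1 := by omega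
  simp only [symComp_diag, hcons, ContinuousMultilinearMap.domDomCongr_apply, finCongr_apply,
    hterm]
  set T : ℕ → EuclideanSpace ℝ (Fin n) →L[ℝ] ℝ := fun j =>
    iteratedFDeriv ℝ j (fderiv ℝ Θ) (x t) fun _ => w with hT
  simp only [← congrFun hT] at key ⊢
  simp only [hexp, Nat.choose_zero_right, Nat.choose_one_right, zero_add, Nat.sub_zero,
    Nat.add_sub_cancel, iteratedFDeriv_zero_apply, Nat.cast_one, one_mul, Nat.cast_add] at key
  linarith
end

section
/- Let F : ℝ^n → ℝ^n be a smooth vector field, U ⊆ ℝ^n open, and Θ : U → ℝ a smooth function with ∇Θ(y)·F(y) = ω constant for all y ∈ U. Let x : I → U be differentiable with x'(t) = F(x(t)). Then the covector Q(t) := ∇Θ(x(t)) satisfies Malkin's adjoint equation Q'(t) = −(DF(x(t)))^⊤ Q(t) for all t ∈ I, where DF(y) is the Jacobian matrix of F at y, (·)^⊤ denotes matrix transpose, and ∇Θ is the gradient of Θ. -/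
open scoped RealInnerProductSpace

/-- The inverse of the Riesz isomorphism of a real Hilbert space, as a linear map. -/
noncomputable def rieszSymm (E : Type*) [NormedAddCommGroup E] [InnerProductSpace ℝ E]
    [CompleteSpace E] : (E →L[ℝ] ℝ) →L[ℝ] E where
  toFun := (InnerProductSpace.toDual ℝ E).symm
  map_add' := map_add _
  map_smul' c f := by simp
  cont := (InnerProductSpace.toDual ℝ E).symm.continuous

section

variable {E : Type*} [NormedAddCommGroup E] [InnerProductSpace ℝ E]

theorem inner_rieszSymm [CompleteSpace E] (f : E →L[ℝ] ℝ) (v : E) : ⟪rieszSymm E f, v⟫ = f v :=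
  InnerProductSpace.toDual_symm_apply

theorem inner_gradient_eq_fderiv [CompleteSpace E] (f : E → ℝ) (y v : E) :
    ⟪gradient f y, v⟫ = fderiv ℝ f y v :=
  InnerProductSpace.toDual_symm_apply

/-- Differentiating the relation `DΘ(y) (F y) = ω` in the direction `v`. -/
theorem fderiv_fderiv_apply_of_eventually_fderiv_apply_eq {Θ : E → ℝ} {F : E → E} {p : E} {ω : ℝ}
    (hΘ : ContDiffAt ℝ 2 Θ p) (hF : DifferentiableAt ℝ F p)
    (h : ∀ᶠ y in nhds p, fderiv ℝ Θ y (F y) = ω) (v : E) :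
    fderiv ℝ (fderiv ℝ Θ) p (F p) v = -fderiv ℝ Θ p (fderiv ℝ F p v) := by
  have hdiff : DifferentiableAt ℝ (fderiv ℝ Θ) p :=
    (hΘ.fderiv_right (m := 1) (by norm_num)).differentiableAt (by norm_num)
  have hsymm : IsSymmSndFDerivAt ℝ Θ p := hΘ.isSymmSndFDerivAt (by simp)
  have hconst : HasFDerivAt (fun y => fderiv ℝ Θ y (F y)) (0 : E →L[ℝ] ℝ) p :=
    (hasFDerivAt_const ω p).congr_of_eventuallyEq h
  have hzero := congrArg (fun L : E →L[ℝ] ℝ => L v)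
    ((hdiff.hasFDerivAt.clm_apply hF.hasFDerivAt).unique hconst)
  simp only [add_apply, ContinuousLinearMap.comp_apply,
    ContinuousLinearMap.flip_apply, zero_apply] at hzero
  rw [hsymm.eq]
  linarith

end

/-- Malkin's adjoint equation: along a trajectory of `F`, the gradient of a phase
function `Θ` (whose derivative along `F` is constant) satisfies
`Q'(t) = −(DF(x(t)))ᵀ Q(t)`, the transpose of the Jacobian acting as the adjoint. -/
theorem stmt_1 {n : ℕ}
    (F : EuclideanSpace ℝ (Fin n) → EuclideanSpace ℝ (Fin n)) (hF : ContDiff ℝ (⊤ : ℕ∞) F)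
    (U : Set (EuclideanSpace ℝ (Fin n))) (hU : IsOpen U)
    (Θ : EuclideanSpace ℝ (Fin n) → ℝ) (hΘ : ContDiffOn ℝ (⊤ : ℕ∞) Θ U)
    (ω : ℝ) (hω : ∀ y ∈ U, ⟪gradient Θ y, F y⟫ = ω)
    (I : Set ℝ) (hIopen : IsOpen I) (hIconn : I.OrdConnected)
    (x : ℝ → EuclideanSpace ℝ (Fin n)) (hxU : ∀ t ∈ I, x t ∈ U)
    (hxode : ∀ t ∈ I, HasDerivAt x (F (x t)) t) :
    ∀ t ∈ I, HasDerivAt (fun s => gradient Θ (x s))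
      (-(ContinuousLinearMap.adjoint (fderiv ℝ F (x t)) (gradient Θ (x t)))) t := by
  intro t ht
  have hΘt : ContDiffAt ℝ 2 Θ (x t) :=
    (hΘ.contDiffAt (hU.mem_nhds (hxU t ht))).of_le (WithTop.coe_le_coe.2 le_top)
  have hdiff : DifferentiableAt ℝ (fderiv ℝ Θ) (x t) :=
    (hΘt.fderiv_right (m := 1) (by norm_num)).differentiableAt (by norm_num)
  have hconst : ∀ᶠ y in nhds (x t), fderiv ℝ Θ y (F y) = ω := by
    filter_upwards [hU.mem_nhds (hxU t ht)] with y hy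
    rw [← inner_gradient_eq_fderiv, hω y hy]
  have hFt : DifferentiableAt ℝ F (x t) := (hF.differentiable (by simp)).differentiableAt
  have hderiv : HasDerivAt (fun s => gradient Θ (x s))
      (rieszSymm _ (fderiv ℝ (fderiv ℝ Θ) (x t) (F (x t)))) t :=
    (rieszSymm _).hasFDerivAt.comp_hasDerivAt t
      (hdiff.hasFDerivAt.comp_hasDerivAt t (hxode t ht))
  convert hderiv using 1
  refine ext_inner_right ℝ fun v => ?_
  rw [inner_rieszSymm, fderiv_fderiv_apply_of_eventually_fderiv_apply_eq hΘt hFt hconst,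
    inner_neg_left, ContinuousLinearMap.adjoint_inner_left, inner_gradient_eq_fderiv]
end

section
/- Let F : ℝ^n → ℝ^n be a smooth vector field and x ↦ Q_x a smooth field of k-multilinear maps (ℝ^n)^k → ℝ. Let DQ denote the field of (k+1)-multilinear maps (DQ)_x(u, v_1,…,v_k) = (D_u Q)_x(v_1,…,v_k). Then for all x ∈ ℝ^n, u ∈ ℝ^n and v_1,…,v_k ∈ ℝ^n: (L_F(DQ))_x(u, v_1,…,v_k) = (D_u(L_F Q))_x(v_1,…,v_k) − Σ_{j=1}^{k} Q_x(v_1,…,F^(2)_x(u, v_j),…,v_k). -/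
/-- Derivative of a multilinear map evaluated with one moving argument, both depending on a
parameter. -/
theorem HasFDerivAt.continuousMultilinearMap_apply_update {𝕜 ι E G H : Type*}
    [NontriviallyNormedField 𝕜] [Fintype ι] [DecidableEq ι]
    [NormedAddCommGroup E] [NormedSpace 𝕜 E] [NormedAddCommGroup G] [NormedSpace 𝕜 G]
    [NormedAddCommGroup H] [NormedSpace 𝕜 H]
    {Q : E → ContinuousMultilinearMap 𝕜 (fun _ : ι => G) H}
    {Q' : E →L[𝕜] ContinuousMultilinearMap 𝕜 (fun _ : ι => G) H}
    {w : E → G} {w' : E →L[𝕜] G} {x : E}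
    (hQ : HasFDerivAt Q Q' x) (hw : HasFDerivAt w w' x) (v : ι → G) (j : ι) :
    HasFDerivAt (fun y => Q y (Function.update v j (w y)))
      (ContinuousMultilinearMap.apply 𝕜 (fun _ : ι => G) H (Function.update v j (w x)) ∘L Q' +
        (Q x).toContinuousLinearMap v j ∘L w') x := by
  have hg (i : ι) : HasFDerivAt (fun y => Function.update v j (w y) i)
      ((Pi.single j w' : ι → E →L[𝕜] G) i) x := by
    rcases eq_or_ne i j with rfl | hij
    · simpa using hw
    · simpa [hij] using hasFDerivAt_const (v i) x
  refine (hQ.continuousMultilinearMap_apply hg).congr_fderiv ?_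
  ext u
  simp only [add_apply, ContinuousLinearMap.comp_apply, add_right_inj]
  rw [Finset.sum_eq_single j]
  · simp
  · intro i _ hij
    simp [hij]
  · simp

/-- Identity for the Lie derivative of the differential `DQ` of a smooth field `Q` of
`k`-multilinear maps: `(L_F(DQ))_x(u,v₁,…,v_k) = (D_u(L_F Q))_x(v₁,…,v_k)
− ∑_j Q_x(v₁,…,F⁽²⁾(u,v_j),…,v_k)`, where
`(L_F Q)_x(v) = (D_{F(x)}Q)_x(v) + ∑_j Q_x(v₁,…,F⁽¹⁾(v_j),…,v_k)`. -/
theorem stmt_3 {n k : ℕ}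
    (F : EuclideanSpace ℝ (Fin n) → EuclideanSpace ℝ (Fin n)) (hF : ContDiff ℝ (⊤ : ℕ∞) F)
    (Q : EuclideanSpace ℝ (Fin n) →
      ContinuousMultilinearMap ℝ (fun _ : Fin k => EuclideanSpace ℝ (Fin n)) ℝ)
    (hQ : ContDiff ℝ (⊤ : ℕ∞) Q)
    (x u : EuclideanSpace ℝ (Fin n)) (v : Fin k → EuclideanSpace ℝ (Fin n)) :
    -- (L_F (DQ))_x(u, v₁,…,v_k), where (DQ)_y(u, v) = (fderiv ℝ Q y u) v :
    (fderiv ℝ (fun y => fderiv ℝ Q y u v) x (F x)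
        + fderiv ℝ Q x (fderiv ℝ F x u) v
        + ∑ j : Fin k, fderiv ℝ Q x u (Function.update v j (fderiv ℝ F x (v j))))
    -- = (D_u (L_F Q))_x(v₁,…,v_k) − ∑_j Q_x(v₁,…,F⁽²⁾(u,v_j),…,v_k) :
    = fderiv ℝ (fun y => fderiv ℝ Q y (F y) v
          + ∑ j : Fin k, Q y (Function.update v j (fderiv ℝ F y (v j)))) x u
      - ∑ j : Fin k, Q x (Function.update v j (iteratedFDeriv ℝ 2 F x ![u, v j])) := by
  have two_le : (2 : WithTop ℕ∞) ≤ ((⊤ : ℕ∞) : WithTop ℕ∞) :=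
    WithTop.coe_le_coe.2 le_top
  have one_add_one_le : (1 : WithTop ℕ∞) + 1 ≤ ((⊤ : ℕ∞) : WithTop ℕ∞) :=
    WithTop.coe_le_coe.2 le_top
  have hF1 : HasFDerivAt F (fderiv ℝ F x) x := (hF.differentiable (by simp) x).hasFDerivAt
  have hQ1 : HasFDerivAt Q (fderiv ℝ Q x) x := (hQ.differentiable (by simp) x).hasFDerivAt
  have hF2 : HasFDerivAt (fderiv ℝ F) (fderiv ℝ (fderiv ℝ F) x) x :=
    ((hF.fderiv_right one_add_one_le).differentiable one_ne_zero x).hasFDerivAt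
  have hQ2 : HasFDerivAt (fderiv ℝ Q) (fderiv ℝ (fderiv ℝ Q) x) x :=
    ((hQ.fderiv_right one_add_one_le).differentiable one_ne_zero x).hasFDerivAt
  have hsymm : fderiv ℝ (fderiv ℝ Q) x (F x) u = fderiv ℝ (fderiv ℝ Q) x u (F x) :=
    (hQ.contDiffAt.isSymmSndFDerivAt (by simpa using two_le)).eq (F x) u
  have hDQ := ((hQ2.clm_apply (hasFDerivAt_const u x)).continuousMultilinear_apply_const v).fderiv
  have hLQ := (((hQ2.clm_apply hF1).continuousMultilinear_apply_const v).fun_add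
    (HasFDerivAt.fun_sum fun j (_ : j ∈ Finset.univ) =>
      hQ1.continuousMultilinearMap_apply_update
        (hF2.clm_apply (hasFDerivAt_const (v j) x)) v j)).fderiv
  rw [hDQ, hLQ]
  simp [iteratedFDeriv_two_apply, hsymm, Finset.sum_add_distrib]
  ring
end

section
/- Assume the hyperbolic periodic orbit setup. Let k ≥ 1 and let (A_t)_{t ≤ 0} be a family of k-multilinear maps (ℝ^n)^k → ℝ, differentiable in t, satisfying the homogeneous equation (d/dt)A_t(v_1,…,v_k) + Σ_{j=1}^{k} A_t(v_1,…,F^(1)_{x(t)}(v_j),…,v_k) = 0 for all t ≤ 0 and all v_1,…,v_k. Then there exist c ∈ ℝ and K > 0 such that ‖A_t − c·Q^(1)_t ⊗ ⋯ ⊗ Q^(1)_t‖ ≤ K λ^{|t|} for all t ≤ 0, where (Q^(1)_t ⊗ ⋯ ⊗ Q^(1)_t)(v_1,…,v_k) = Π_{j=1}^k Q^(1)_t(v_j) (k factors). Moreover, if A_t is defined and satisfies the equation for all t ∈ ℝ and is T-periodic, then A_t = c·Q^(1)_t ⊗ ⋯ ⊗ Q^(1)_t for all t. -/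
open scoped BigOperators

/-- The `k`-fold tensor power `q ⊗ ⋯ ⊗ q` of a linear functional, as a continuous
`k`-multilinear map: `(q ⊗ ⋯ ⊗ q)(v₁,…,v_k) = ∏ⱼ q(vⱼ)`. -/
noncomputable def tensorPow {E : Type*} [NormedAddCommGroup E] [NormedSpace ℝ E]
    (k : ℕ) (q : E →L[ℝ] ℝ) : ContinuousMultilinearMap ℝ (fun _ : Fin k => E) ℝ :=
  (ContinuousMultilinearMap.mkPiAlgebra ℝ (Fin k) ℝ).compContinuousLinearMap fun _ => q

section TensorTransport

variable {E : Type*} [NormedAddCommGroup E] [NormedSpace ℝ E]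

@[simp]
theorem tensorPow_apply (k : ℕ) (q : E →L[ℝ] ℝ) (v : Fin k → E) :
    tensorPow k q v = ∏ j, q (v j) := by
  simp [tensorPow]

theorem tensorPow_comp (k : ℕ) (q : E →L[ℝ] ℝ) (U : E →L[ℝ] E) :
    tensorPow k (q.comp U) = (tensorPow k q).compContinuousLinearMap fun _ => U := by
  ext v
  simp

variable [FiniteDimensional ℝ E]

/-- Expansion of a multilinear form in the coordinates of a basis. -/
theorem ContinuousMultilinearMap.apply_eq_sum_basis {ι κ : Type*} [Fintype ι] [DecidableEq ι]
    [Fintype κ]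
    (b : Module.Basis κ ℝ E) (M : ContinuousMultilinearMap ℝ (fun _ : ι => E) ℝ) (v : ι → E) :
    M v = ∑ r : ι → κ, M (fun j => b (r j)) *
      ((ContinuousMultilinearMap.mkPiAlgebra ℝ ι ℝ).compContinuousLinearMap
        fun j => LinearMap.toContinuousLinearMap (b.coord (r j))) v := by
  have hv : v = fun j => ∑ i, b.repr (v j) i • b i := by
    ext1 j
    exact (b.sum_repr (v j)).symm
  conv_lhs => rw [hv]
  rw [M.map_sum]
  refine Finset.sum_congr rfl fun r _ => ?_
  rw [M.map_smul_univ]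
  simp [mul_comm]

/-- Leibniz rule for evaluating a pointwise differentiable family of multilinear forms along
differentiable curves. -/
theorem ContinuousMultilinearMap.hasDerivAt_apply_of_pointwise {ι : Type*} [Fintype ι]
    [DecidableEq ι]
    {A : ℝ → ContinuousMultilinearMap ℝ (fun _ : ι => E) ℝ} {A' : (ι → E) → ℝ} {t : ℝ}
    (hA : ∀ v, HasDerivAt (fun s => A s v) (A' v) t) {u : ℝ → ι → E} {u' : ι → E}
    (hu : HasDerivAt u u' t) :
    HasDerivAt (fun s => A s (u s))
      (A' (u t) + ∑ i, A t (Function.update (u t) i (u' i))) t := by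
  let b := Module.finBasis ℝ E
  let P := fun r : ι → Fin (Module.finrank ℝ E) =>
    (ContinuousMultilinearMap.mkPiAlgebra ℝ ι ℝ).compContinuousLinearMap
        fun j => LinearMap.toContinuousLinearMap (b.coord (r j))
  have hexp : ∀ s v, A s v = ∑ r, A s (fun j => b (r j)) * P r v :=
    fun s v => (A s).apply_eq_sum_basis b v
  have hA' : ∀ v, A' v = ∑ r, A' (fun j => b (r j)) * P r v := by
    intro v
    refine (hA v).unique ?_
    simp_rw [hexp _ v]
    exact HasDerivAt.fun_sum fun r _ => (hA _).mul_const _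
  have hP : ∀ r, HasDerivAt (fun s => P r (u s))
      (∑ i, P r (Function.update (u t) i (u' i))) t := by
    intro r
    have := ((P r).hasFDerivAt (u t)).comp_hasDerivAt t hu
    rwa [ContinuousMultilinearMap.linearDeriv_apply] at this
  have key : HasDerivAt (fun s => ∑ r, A s (fun j => b (r j)) * P r (u s))
      (∑ r, (A' (fun j => b (r j)) * P r (u t) +
        A t (fun j => b (r j)) * ∑ i, P r (Function.update (u t) i (u' i)))) t :=
    HasDerivAt.fun_sum fun r _ => (hA _).mul (hP r)
  simp_rw [← hexp] at key
  convert key using 1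
  rw [Finset.sum_add_distrib, ← hA']
  congr 1
  simp_rw [Finset.mul_sum]
  rw [Finset.sum_comm]
  exact Finset.sum_congr rfl fun i _ => hexp _ _

/-- A solution of the adjoint tensor equation is constant along solutions of the linear
equation `u' = L u`. -/
theorem ContinuousMultilinearMap.apply_eq_of_adjoint_equation {ι : Type*} [Fintype ι]
    [DecidableEq ι]
    {L : ℝ → E →L[ℝ] E} {A : ℝ → ContinuousMultilinearMap ℝ (fun _ : ι => E) ℝ} {a b : ℝ}
    (hab : a ≤ b)
    (hA : ∀ t ≤ b, ∀ v, HasDerivAt (fun s => A s v)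
      (-∑ j, A t (Function.update v j (L t (v j)))) t)
    {u : ℝ → ι → E} (hu : ∀ t, HasDerivAt u (fun j => L t (u t j)) t) :
    A a (u a) = A b (u b) := by
  have h : ∀ t ≤ b, HasDerivAt (fun s => A s (u s)) 0 t := by
    intro t ht
    have := ContinuousMultilinearMap.hasDerivAt_apply_of_pointwise (hA t ht) (hu t)
    simpa using this
  exact (constant_of_has_deriv_right_zero
    (fun t ht => (h t ht.2).continuousAt.continuousWithinAt)
    (fun t ht => (h t ht.2.le).hasDerivWithinAt) b ⟨hab, le_rfl⟩).symm

end TensorTransport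

section Flow

variable {E : Type*} [NormedAddCommGroup E] [NormedSpace ℝ E]

/-- The flow property, from uniqueness for `y' = F y`. -/
theorem flow_add [FiniteDimensional ℝ E] {F : E → E} (hF : ContDiff ℝ 1 F) {φ : ℝ → E → E}
    (hφ0 : ∀ y, φ 0 y = y) (hφflow : ∀ t y, HasDerivAt (fun s => φ s y) (F (φ t y)) t)
    (s t : ℝ) (y : E) : φ s (φ t y) = φ (t + s) y := by
  have hf : ∀ r, HasDerivAt (fun r => φ r (φ t y)) (F (φ r (φ t y))) r := fun r => hφflow r _
  have hg : ∀ r, HasDerivAt (fun r => φ (t + r) y) (F (φ (t + r) y)) r := fun r =>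
    HasDerivAt.comp_const_add t r (hφflow (t + r) y)
  have hfc : Continuous fun r => φ r (φ t y) :=
    continuous_iff_continuousAt.2 fun r => (hf r).continuousAt
  have hgc : Continuous fun r => φ (t + r) y :=
    continuous_iff_continuousAt.2 fun r => (hg r).continuousAt
  let I := Set.Icc (-(|s| + 1)) (|s| + 1)
  have hI : IsCompact I := isCompact_Icc
  obtain ⟨R, hR⟩ := ((hI.image hfc).isBounded.union (hI.image hgc).isBounded).subset_closedBall 0
  obtain ⟨M, hM⟩ := (isCompact_closedBall (0 : E) R).exists_bound_of_continuousOn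
    (hF.continuous_fderiv one_ne_zero).continuousOn
  have hLip : LipschitzOnWith M.toNNReal F (Metric.closedBall 0 R) := by
    refine (convex_closedBall (0 : E) R).lipschitzOnWith_of_nnnorm_fderiv_le
      (fun z _ => (hF.differentiable one_ne_zero) z) fun z hz => ?_
    rw [← NNReal.coe_le_coe]
    exact (hM z hz).trans (Real.le_coe_toNNReal M)
  have hs := neg_abs_le s
  have hs' := le_abs_self s
  refine ODE_solution_unique_of_mem_Icc (v := fun _ => F) (s := fun _ => Metric.closedBall 0 R)
    (t₀ := 0) (fun _ _ => hLip) ⟨by linarith [abs_nonneg s], by linarith [abs_nonneg s]⟩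
    hfc.continuousOn (fun r _ => hf r)
    (fun r hr => hR (Or.inl ⟨r, Set.Ioo_subset_Icc_self hr, rfl⟩))
    hgc.continuousOn (fun r _ => hg r)
    (fun r hr => hR (Or.inr ⟨r, Set.Ioo_subset_Icc_self hr, rfl⟩))
    (by simp [hφ0]) ⟨by linarith, by linarith⟩

/-- The variational equation `(dφ_s)' = F' ∘ dφ_s`. -/
theorem hasDerivAt_fderiv_flow {F : E → E} (hF : Differentiable ℝ F) {φ : ℝ → E → E}
    (hφsmooth : ContDiff ℝ 2 fun p : ℝ × E => φ p.1 p.2)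
    (hφflow : ∀ t y, HasDerivAt (fun s => φ s y) (F (φ t y)) t) (s : ℝ) (y v : E) :
    HasDerivAt (fun r => fderiv ℝ (φ r) y v) (fderiv ℝ F (φ s y) (fderiv ℝ (φ s) y v)) s := by
  let Φ := fun p : ℝ × E => φ p.1 p.2
  have hΦ : Differentiable ℝ Φ := hφsmooth.differentiable two_ne_zero
  have hD : Differentiable ℝ (fderiv ℝ Φ) :=
    (hφsmooth.fderiv_right (m := 1) (by norm_num)).differentiable one_ne_zero
  have htime : ∀ p, fderiv ℝ Φ p (1, 0) = F (Φ p) := fun p => by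
    have h := (hΦ p).hasFDerivAt.comp_hasDerivAt_of_eq p.1
      ((hasDerivAt_id p.1).prodMk (hasDerivAt_const p.1 p.2)) rfl
    exact h.unique (hφflow p.1 p.2)
  have hspace : ∀ r z, HasFDerivAt (φ r)
      ((fderiv ℝ Φ (r, z)).comp (ContinuousLinearMap.inr ℝ ℝ E)) z := fun r z =>
    (hΦ (r, z)).hasFDerivAt.comp z (hasFDerivAt_prodMk_right r z)
  have hsymm : fderiv ℝ (fderiv ℝ Φ) (s, y) (1, 0) (0, v) =
      fderiv ℝ (fderiv ℝ Φ) (s, y) (0, v) (1, 0) :=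
    (hφsmooth.contDiffAt.isSymmSndFDerivAt (by simp)) _ _
  have h1 : HasDerivAt (fun r => fderiv ℝ (φ r) y v)
      (fderiv ℝ (fderiv ℝ Φ) (s, y) (1, 0) (0, v)) s := by
    have h := (hD (s, y)).hasFDerivAt.comp_hasDerivAt_of_eq s
      ((hasDerivAt_id s).prodMk (hasDerivAt_const s y)) rfl
    have h' := h.clm_apply (hasDerivAt_const s ((0 : ℝ), v))
    simp only [map_zero, add_zero] at h'
    refine h'.congr_of_eventuallyEq (Filter.Eventually.of_forall fun r => ?_)
    simp [(hspace r y).fderiv]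
  have h2 : fderiv ℝ (fderiv ℝ Φ) (s, y) (0, v) (1, 0) =
      fderiv ℝ F (φ s y) (fderiv ℝ (φ s) y v) := by
    have e1 : HasFDerivAt (fun p => fderiv ℝ Φ p (1, 0))
        ((fderiv ℝ (fderiv ℝ Φ) (s, y)).flip (1, 0)) (s, y) := by
      simpa using (hD (s, y)).hasFDerivAt.clm_apply (hasFDerivAt_const ((1 : ℝ), (0 : E)) (s, y))
    have e2 : HasFDerivAt (fun p => F (Φ p))
        ((fderiv ℝ F (Φ (s, y))).comp (fderiv ℝ Φ (s, y))) (s, y) :=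
      (hF _).hasFDerivAt.comp (s, y) (hΦ (s, y)).hasFDerivAt
    simp_rw [htime] at e1
    have := DFunLike.congr_fun (e1.unique e2) ((0 : ℝ), v)
    simpa [(hspace s y).fderiv] using this
  rw [← h2, ← hsymm]
  exact h1

/-- The derivative of the flow carries the vector field along the orbit. -/
theorem fderiv_flow_apply_vectorField {F : E → E} {φ : ℝ → E → E}
    (hφsmooth : ContDiff ℝ 1 fun p : ℝ × E => φ p.1 p.2)
    (hφflow : ∀ t y, HasDerivAt (fun s => φ s y) (F (φ t y)) t)
    (hadd : ∀ s t y, φ s (φ t y) = φ (t + s) y) (s t : ℝ) (y : E) :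
    fderiv ℝ (φ s) (φ t y) (F (φ t y)) = F (φ (t + s) y) := by
  have hd : Differentiable ℝ (φ s) :=
    (hφsmooth.comp (contDiff_prodMk_right s)).differentiable one_ne_zero
  have h1 := (hd (φ t y)).hasFDerivAt.comp_hasDerivAt t (hφflow t y)
  have h2 : HasDerivAt (fun r => φ (r + s) y) (F (φ (t + s) y)) t :=
    HasDerivAt.comp_add_const t s (hφflow (t + s) y)
  refine h1.unique (h2.congr_of_eventuallyEq (Filter.Eventually.of_forall fun r => ?_))
  exact hadd s r y

end Flow

/-- Quantitative continuity of the pullback of a multilinear form by a linear map. -/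
theorem ContinuousMultilinearMap.norm_compContinuousLinearMap_sub_le {E : Type*}
    [NormedAddCommGroup E] [NormedSpace ℝ E] {k : ℕ}
    (B : ContinuousMultilinearMap ℝ (fun _ : Fin k => E) ℝ) {U P : E →L[ℝ] E} {M : ℝ}
    (hU : ‖U‖ ≤ M) (hP : ‖P‖ ≤ M) :
    ‖B.compContinuousLinearMap (fun _ => U) - B.compContinuousLinearMap (fun _ => P)‖ ≤
      ‖B‖ * k * M ^ (k - 1) * ‖U - P‖ := by
  have hM : 0 ≤ M := (norm_nonneg U).trans hU
  have hc : ∀ {V : E →L[ℝ] E} {m : ℝ}, 0 ≤ m → ‖V‖ ≤ m → ‖fun _ : Fin k => V‖ ≤ m :=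
    fun hm hV => (pi_norm_le_iff_of_nonneg hm).2 fun _ => hV
  have h := (ContinuousMultilinearMap.compContinuousLinearMapLRight
    (E := fun _ : Fin k => E) B).norm_image_sub_le (fun _ => U) (fun _ => P)
  refine h.trans ?_
  rw [Fintype.card_fin]
  gcongr
  · exact MultilinearMap.mkContinuous_norm_le _ (norm_nonneg _) _
  · exact max_le (hc hM hU) (hc hM hP)
  · exact hc (norm_nonneg _) le_rfl

/-- A solution of the adjoint equation on covectors is constant along solutions of the linear
equation `u' = L u`. -/
theorem ContinuousLinearMap.apply_eq_of_adjoint_equation {E : Type*} [NormedAddCommGroup E]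
    [NormedSpace ℝ E] [FiniteDimensional ℝ E] {L : ℝ → E →L[ℝ] E} {Q : ℝ → E →L[ℝ] ℝ} {a b : ℝ}
    (hab : a ≤ b) (hQ : ∀ t v, HasDerivAt (fun s => Q s v) (-(Q t (L t v))) t)
    {u : ℝ → E} (hu : ∀ t, HasDerivAt u (L t (u t)) t) :
    Q a (u a) = Q b (u b) := by
  have h := ContinuousMultilinearMap.apply_eq_of_adjoint_equation (ι := Fin 1) (L := L)
    (A := fun t => ContinuousMultilinearMap.ofSubsingleton ℝ E ℝ 0 (Q t)) hab
    (fun t _ v => by simpa using hQ t (v 0)) (u := fun t _ => u t)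
    (fun t => hasDerivAt_pi.2 fun _ => hu t)
  simpa using h

/-- A periodic, pointwise continuous family of functionals is uniformly bounded. -/
theorem exists_norm_le_of_periodic_of_pointwise_continuous {E : Type*} [NormedAddCommGroup E]
    [NormedSpace ℝ E] [CompleteSpace E] {Q : ℝ → E →L[ℝ] ℝ} {T : ℝ} (hT : T ≠ 0)
    (hper : ∀ t, Q (t + T) = Q t) (hcont : ∀ v, Continuous fun t => Q t v) :
    ∃ M, ∀ t, ‖Q t‖ ≤ M := by
  refine banach_steinhaus fun v => ?_
  have hp : Function.Periodic (fun t => Q t v) T := fun t => by simp [hper t]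
  obtain ⟨M, hM⟩ := (hp.isBounded_of_continuous hT (hcont v)).exists_norm_le
  exact ⟨M, fun t => hM _ ⟨t, rfl⟩⟩

/-- A `T`-periodic function which tends to zero exponentially at `-∞` vanishes. -/
theorem eq_zero_of_periodic_of_norm_le_rpow {V : Type*} [NormedAddCommGroup V] {D : ℝ → V}
    {T K lam : ℝ} (hT : 0 < T) (hper : Function.Periodic D T) (hlam0 : 0 < lam) (hlam1 : lam < 1)
    (hD : ∀ t ≤ 0, ‖D t‖ ≤ K * lam ^ |t|) (t : ℝ) : D t = 0 := by
  have hmul : Filter.Tendsto (fun m : ℕ => (m : ℝ) * T) Filter.atTop Filter.atTop :=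
    tendsto_natCast_atTop_atTop.atTop_mul_const hT
  have hbot : Filter.Tendsto (fun m : ℕ => t - m * T) Filter.atTop Filter.atBot :=
    Filter.tendsto_atBot_add_const_left _ t (Filter.tendsto_neg_atTop_atBot.comp hmul)
  have hlim : Filter.Tendsto (fun m : ℕ => K * lam ^ |t - m * T|) Filter.atTop (nhds (K * 0)) :=
    ((tendsto_rpow_atTop_of_base_lt_one lam (by linarith) hlam1).comp
      (Filter.tendsto_abs_atBot_atTop.comp hbot)).const_mul K
  rw [mul_zero] at hlim
  refine norm_le_zero_iff.1 (ge_of_tendsto hlim ?_)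
  filter_upwards [hbot.eventually_le_atBot 0] with m hm
  rw [← hper.sub_nat_mul_eq m]
  exact hD _ hm

/-- Homogeneous solutions of the variational tensor equation along a hyperbolic periodic
orbit: any solution for `t ≤ 0` approaches a multiple of the `k`-th tensor power of the
first-order phase covector `Q⁽¹⁾` exponentially fast, and a globally defined `T`-periodic
solution is exactly such a multiple. -/
theorem stmt_8 {n : ℕ}
    (F : EuclideanSpace ℝ (Fin n) → EuclideanSpace ℝ (Fin n)) (hF : ContDiff ℝ (⊤ : ℕ∞) F)
    (φ : ℝ → EuclideanSpace ℝ (Fin n) → EuclideanSpace ℝ (Fin n))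
    (hφ0 : ∀ y, φ 0 y = y)
    (hφsmooth : ContDiff ℝ (⊤ : ℕ∞) fun p : ℝ × EuclideanSpace ℝ (Fin n) => φ p.1 p.2)
    (hφflow : ∀ t y, HasDerivAt (fun s => φ s y) (F (φ t y)) t)
    (hφbij : ∀ t, Function.Bijective (φ t))
    (x : EuclideanSpace ℝ (Fin n)) (T : ℝ) (hT : 0 < T)
    (hper : φ T x = x) (hFx : F x ≠ 0)
    (W : ℝ → Submodule ℝ (EuclideanSpace ℝ (Fin n)))
    (hWcompl : ∀ t, IsCompl (Submodule.span ℝ {F (φ t x)}) (W t))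
    (hWinv : ∀ s t, Submodule.map (fderiv ℝ (φ s) (φ t x) : _ →ₗ[ℝ] _) (W t) = W (t + s))
    (hWper : ∀ t, W (t + T) = W t)
    (C lam : ℝ) (hC : 0 < C) (hlam0 : 0 < lam) (hlam1 : lam < 1)
    (hcontr : ∀ t : ℝ, ∀ s : ℝ, 0 ≤ s → ∀ v ∈ W t,
      ‖fderiv ℝ (φ s) (φ t x) v‖ ≤ C * lam ^ s * ‖v‖)
    (Q1 : ℝ → (EuclideanSpace ℝ (Fin n) →L[ℝ] ℝ))
    (hQ1per : ∀ t, Q1 (t + T) = Q1 t)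
    (hQ1ode : ∀ (t : ℝ) (v : EuclideanSpace ℝ (Fin n)),
      HasDerivAt (fun s => Q1 s v) (-(Q1 t (fderiv ℝ F (φ t x) v))) t)
    (hQ1norm : ∀ t, Q1 t (F (φ t x)) = 1 / T)
    (k : ℕ) (hk : 1 ≤ k)
    (A : ℝ → ContinuousMultilinearMap ℝ (fun _ : Fin k => EuclideanSpace ℝ (Fin n)) ℝ)
    (hA : ∀ t ≤ (0 : ℝ), ∀ v : Fin k → EuclideanSpace ℝ (Fin n),
      HasDerivAt (fun s => A s v)
        (-∑ j : Fin k, A t (Function.update v j (fderiv ℝ F (φ t x) (v j)))) t) :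
    ∃ c K : ℝ, 0 < K ∧
      (∀ t ≤ (0 : ℝ), ‖A t - c • tensorPow k (Q1 t)‖ ≤ K * lam ^ |t|) ∧
      ((∀ (t : ℝ) (v : Fin k → EuclideanSpace ℝ (Fin n)),
          HasDerivAt (fun s => A s v)
            (-∑ j : Fin k, A t (Function.update v j (fderiv ℝ F (φ t x) (v j)))) t) →
        (∀ t, A (t + T) = A t) →
        ∀ t, A t = c • tensorPow k (Q1 t)) := by
  have hadd : ∀ s t y, φ s (φ t y) = φ (t + s) y :=
    flow_add (hF.of_le (by exact_mod_cast le_top)) hφ0 hφflow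
  have hφ0' : φ 0 = id := funext hφ0
  have hvar : ∀ t v τ, HasDerivAt (fun r => fderiv ℝ (φ (r - t)) (φ t x) v)
      (fderiv ℝ F (φ τ x) (fderiv ℝ (φ (τ - t)) (φ t x) v)) τ := by
    intro t v τ
    have h := HasDerivAt.comp_sub_const τ t
      (hasDerivAt_fderiv_flow (hF.differentiable (by simp))
        (by exact_mod_cast contDiff_infty.1 hφsmooth 2) hφflow (τ - t) (φ t x) v)
    rwa [hadd, add_sub_cancel] at h
  have hflowF : ∀ s t, fderiv ℝ (φ s) (φ t x) (F (φ t x)) = F (φ (t + s) x) := fun s t =>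
    fderiv_flow_apply_vectorField (hφsmooth.of_le (by exact_mod_cast le_top)) hφflow hadd s t x
  have htransA : ∀ t ≤ 0,
      A t = (A 0).compContinuousLinearMap fun _ => fderiv ℝ (φ (-t)) (φ t x) := by
    intro t ht
    ext v
    have h := ContinuousMultilinearMap.apply_eq_of_adjoint_equation
      (L := fun τ => fderiv ℝ F (φ τ x)) ht hA
      (u := fun τ j => fderiv ℝ (φ (τ - t)) (φ t x) (v j))
      (fun τ => hasDerivAt_pi.2 fun j => hvar t (v j) τ)
    simpa [hφ0'] using h
  have htransQ : ∀ t s, 0 ≤ s → Q1 t = (Q1 (t + s)).comp (fderiv ℝ (φ s) (φ t x)) := by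
    intro t s hs
    ext1 v
    have h := ContinuousLinearMap.apply_eq_of_adjoint_equation
      (L := fun τ => fderiv ℝ F (φ τ x)) (le_add_of_nonneg_right (a := t) hs) hQ1ode (hvar t v)
    simpa [hφ0'] using h
  obtain ⟨MQ, hMQ⟩ := exists_norm_le_of_periodic_of_pointwise_continuous hT.ne' hQ1per
    fun v => continuous_iff_continuousAt.2 fun t => (hQ1ode t v).continuousAt
  obtain ⟨MF, hMF⟩ : ∃ M, ∀ t, ‖F (φ t x)‖ ≤ M := by
    have hp : Function.Periodic (fun t => F (φ t x)) T := fun t => by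
      simp only [add_comm t T, ← hadd t T x, hper]
    have hc : Continuous fun t => F (φ t x) :=
      hF.continuous.comp (continuous_iff_continuousAt.2 fun t => (hφflow t x).continuousAt)
    obtain ⟨M, hM⟩ := (hp.isBounded_of_continuous hT.ne' hc).exists_norm_le
    exact ⟨M, fun t => hM _ ⟨t, rfl⟩⟩
  have hMQ0 : 0 ≤ MQ := (norm_nonneg _).trans (hMQ 0)
  have hMF0 : 0 ≤ MF := (norm_nonneg _).trans (hMF 0)
  have hQW : ∀ t, ∀ w ∈ W t, Q1 t w = 0 := by
    intro t w hw
    have hlim : Filter.Tendsto (fun s : ℝ => MQ * (C * lam ^ s * ‖w‖)) Filter.atTop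
        (nhds (MQ * (C * 0 * ‖w‖))) :=
      (((tendsto_rpow_atTop_of_base_lt_one lam (by linarith) hlam1).const_mul C).mul_const
        ‖w‖).const_mul MQ
    rw [mul_zero, zero_mul, mul_zero] at hlim
    refine norm_le_zero_iff.1 (ge_of_tendsto hlim ?_)
    filter_upwards [Filter.eventually_ge_atTop 0] with s hs
    rw [htransQ t s hs]
    exact ((Q1 (t + s)).le_opNorm _).trans
      (mul_le_mul (hMQ _) (hcontr t s hs w hw) (norm_nonneg _) hMQ0)
  have hproj : ∀ t v, v - (T * Q1 t v) • F (φ t x) ∈ W t := by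
    intro t v
    obtain ⟨y, hy, w, hw, rfl⟩ := Submodule.mem_sup.1
      ((hWcompl t).sup_eq_top ▸ Submodule.mem_top : v ∈ Submodule.span ℝ {F (φ t x)} ⊔ W t)
    obtain ⟨a, rfl⟩ := Submodule.mem_span_singleton.1 hy
    have : T * Q1 t (a • F (φ t x) + w) = a := by
      rw [map_add, hQW t w hw, map_smul, hQ1norm, smul_eq_mul]
      field_simp
      ring
    rwa [this, add_sub_cancel_left]
  let c : ℝ := T ^ k * A 0 fun _ => F x
  let B := A 0 - c • tensorPow k (Q1 0)
  have hBF : B (fun _ => F x) = 0 := by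
    have hQ0 : Q1 0 (F x) = 1 / T := by simpa [hφ0] using hQ1norm 0
    have hTk : T ^ k ≠ 0 := pow_ne_zero k hT.ne'
    simp only [B, c, sub_apply, smul_apply, tensorPow_apply, hQ0, Finset.prod_const,
      Finset.card_univ, Fintype.card_fin, smul_eq_mul, one_div, inv_pow]
    field_simp
    ring
  let N := T * (MQ * MF)
  have hN : 0 ≤ N := by positivity
  let G := C * (1 + N)
  have hG : 0 < G := by positivity
  have hbound : ∀ t ≤ (0 : ℝ), ‖A t - c • tensorPow k (Q1 t)‖ ≤
      (‖B‖ * k * (N + G) ^ (k - 1) * G + 1) * lam ^ |t| := by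
    intro t ht
    have ht' : 0 ≤ -t := neg_nonneg.2 ht
    let U := fderiv ℝ (φ (-t)) (φ t x)
    let P : EuclideanSpace ℝ (Fin n) →L[ℝ] EuclideanSpace ℝ (Fin n) :=
      T • (Q1 t).smulRight (F x)
    have hrank : ∀ v, ‖(T * Q1 t v) • F (φ t x)‖ ≤ N * ‖v‖ := fun v => by
      rw [norm_smul, norm_mul, Real.norm_of_nonneg hT.le]
      calc T * ‖Q1 t v‖ * ‖F (φ t x)‖ ≤ T * (MQ * ‖v‖) * MF := by
            gcongr
            · exact (Q1 t).le_of_opNorm_le (hMQ t) v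
            · exact hMF t
        _ = N * ‖v‖ := by ring
    have hP : ‖P‖ ≤ N := by
      rw [norm_smul, ContinuousLinearMap.norm_smulRight_apply, Real.norm_of_nonneg hT.le]
      have := hMF 0
      rw [hφ0] at this
      change T * (‖Q1 t‖ * ‖F x‖) ≤ T * (MQ * MF)
      gcongr
      exact hMQ t
    have hUF : U (F (φ t x)) = F x := by
      rw [hflowF, add_neg_cancel, hφ0]
    have hUP : ‖U - P‖ ≤ G * lam ^ |t| := by
      refine ContinuousLinearMap.opNorm_le_bound _ (by positivity) fun v => ?_
      have hsplit : (U - P) v = U (v - (T * Q1 t v) • F (φ t x)) := by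
        simp [P, hUF, mul_smul]
      rw [hsplit, abs_of_nonpos ht]
      refine (hcontr t (-t) ht' _ (hproj t v)).trans ?_
      have : ‖v - (T * Q1 t v) • F (φ t x)‖ ≤ (1 + N) * ‖v‖ :=
        (norm_sub_le _ _).trans (by linarith [hrank v])
      calc C * lam ^ (-t) * ‖v - (T * Q1 t v) • F (φ t x)‖
          ≤ C * lam ^ (-t) * ((1 + N) * ‖v‖) := by gcongr
        _ = G * lam ^ (-t) * ‖v‖ := by ring
    have hpow : lam ^ |t| ≤ 1 := Real.rpow_le_one hlam0.le hlam1.le (abs_nonneg t)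
    have hU : ‖U‖ ≤ N + G := by
      calc ‖U‖ = ‖P + (U - P)‖ := by rw [add_sub_cancel]
        _ ≤ ‖P‖ + ‖U - P‖ := norm_add_le _ _
        _ ≤ N + G := add_le_add hP (hUP.trans (mul_le_of_le_one_right hG.le hpow))
    have hBP : B.compContinuousLinearMap (fun _ => P) = 0 := by
      ext v
      have : (fun j => P (v j)) = fun j => (T * Q1 t (v j)) • F x := by
        ext1 j
        simp [P, mul_smul]
      rw [ContinuousMultilinearMap.compContinuousLinearMap_apply, this,
        B.map_smul_univ (fun j => T * Q1 t (v j)) (fun _ => F x), hBF, smul_zero]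
      rfl
    have hpull : A t - c • tensorPow k (Q1 t) = B.compContinuousLinearMap fun _ => U := by
      have hQ := htransQ t (-t) ht'
      rw [add_neg_cancel] at hQ
      rw [htransA t ht, hQ, tensorPow_comp]
      rfl
    have h := B.norm_compContinuousLinearMap_sub_le hU (hP.trans (le_add_of_nonneg_right hG.le))
    rw [hBP, sub_zero, ← hpull] at h
    calc ‖A t - c • tensorPow k (Q1 t)‖
        ≤ ‖B‖ * k * (N + G) ^ (k - 1) * ‖U - P‖ := h
      _ ≤ ‖B‖ * k * (N + G) ^ (k - 1) * (G * lam ^ |t|) := by gcongr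
      _ ≤ (‖B‖ * k * (N + G) ^ (k - 1) * G + 1) * lam ^ |t| := by
        nlinarith [Real.rpow_nonneg hlam0.le |t|]
  refine ⟨c, ‖B‖ * k * (N + G) ^ (k - 1) * G + 1, by positivity, hbound, fun _ hAper t => ?_⟩
  exact sub_eq_zero.1 (eq_zero_of_periodic_of_norm_le_rpow
    (D := fun t => A t - c • tensorPow k (Q1 t)) hT
    (fun t => by simp only [hAper t, hQ1per t]) hlam0 hlam1 hbound t)
end
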